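/- arXiv:1603.07915 — 6 statements merged into one kernel-verified Lean document; each statement's English description precedes it below -/
import Mathlib

section
/- Let E be a complex normed space, x ∈ E, r ∈ ℕ, and let X₁,…,X_r : E → E be vector fields, each differentiable at x. Let λ : Fin r × Fin r × Fin r → ℂ be constants such that [Xᵢ,Xⱼ](x) = Σ_k λᵢⱼᵏ · Xₖ(x) for all i,j. Let a : Fin r × Fin r → (E → ℂ) be functions, each differentiable at x, with aᵢⱼ(x) = δᵢⱼ and satisfying, for all i,j,k, the relation (D aᵢⱼ)ₓ(Xₖ(x)) = − Σ_α λ_{kα}^{i} · a_{αj}(x). Define the vector fields Yᵢ = Σ_j a_{ji} · Xⱼ. Then for all i,j one has [Yᵢ,Yⱼ](x) = − Σ_k λᵢⱼᵏ · Xₖ(x) (equivalently, since Yₖ(x) = Xₖ(x), [Yᵢ,Yⱼ](x) = Σ_k λ_{ji}^{k} · Yₖ(x)). -/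
open VectorField

/-- Lemma 3.3: a family of symmetry vector fields `Y i = ∑ j, a j i • X j`, normalized so that
`a i j x = δᵢⱼ` and satisfying the horizontality ODE for the reciprocal connection, has at `x`
the commutation relations with the opposite structure constants. -/
theorem stmt0
    {E : Type*} [NormedAddCommGroup E] [NormedSpace ℂ E]
    (x : E) (r : ℕ) (X : Fin r → E → E)
    (hX : ∀ i, DifferentiableAt ℂ (X i) x)
    (lam : Fin r → Fin r → Fin r → ℂ)
    (hlam : ∀ i j, lieBracket ℂ (X i) (X j) x = ∑ k, lam i j k • X k x)
    (a : Fin r → Fin r → E → ℂ)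
    (ha : ∀ i j, DifferentiableAt ℂ (a i j) x)
    (ha_init : ∀ i j, a i j x = if i = j then (1 : ℂ) else 0)
    (ha_ode : ∀ i j k, fderiv ℂ (a i j) x (X k x) = - ∑ α, lam k α i * a α j x)
    (Y : Fin r → E → E)
    (hY : ∀ i, Y i = fun p => ∑ j, a j i p • X j p) :
    ∀ i j, lieBracket ℂ (Y i) (Y j) x = - ∑ k, lam i j k • X k x := by
  have hY_apply (i : Fin r) : Y i x = X i x := by
    simp [hY, ha_init]
  have hY_fderiv (i j : Fin r) :
      fderiv ℂ (Y j) x (X i x) = fderiv ℂ (X j) x (X i x) - lieBracket ℂ (X i) (X j) x := by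
    rw [hY, fderiv_fun_sum fun k _ => (ha k j).fun_smul (hX k), hlam]
    simp [fderiv_fun_smul (ha _ j) (hX _), Finset.sum_add_distrib, ha_init, ha_ode,
      sub_eq_add_neg]
  intro i j
  rw [← hlam, lieBracket_eq]
  simp only [hY_apply, hY_fderiv, lieBracket_eq]
  abel
end

section
/- Let E be a complex normed space, x ∈ E, r ∈ ℕ, and let X₁,…,X_r : E → E be vector fields, each differentiable at x, such that the vectors X₁(x),…,X_r(x) are linearly independent. Let λ : Fin r × Fin r × Fin r → ℂ be constants with [Xⱼ,Xᵢ](x) = Σ_k λ_{ji}^{k} · Xₖ(x) for all i,j. Let f : Fin r → (E → ℂ) be functions, each differentiable at x, and set Y = Σ_k fₖ · Xₖ. Then for each j: [Xⱼ,Y](x) = 0 if and only if for every k one has (D fₖ)ₓ(Xⱼ(x)) + Σ_i fᵢ(x) · λ_{ji}^{k} = 0. -/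
open VectorField

/-- The Lie bracket is additive over finite sums in its second argument. -/
theorem lieBracket_fun_sum_right {𝕜 E ι : Type*} [NontriviallyNormedField 𝕜]
    [NormedAddCommGroup E] [NormedSpace 𝕜 E] {x : E} {V : E → E} {W : ι → E → E} {s : Finset ι}
    (hW : ∀ i ∈ s, DifferentiableAt 𝕜 (W i) x) :
    lieBracket 𝕜 V (fun p => ∑ i ∈ s, W i p) x = ∑ i ∈ s, lieBracket 𝕜 V (W i) x := by
  simp only [lieBracket_eq]
  rw [fderiv_fun_sum hW, map_sum, sum_apply, Finset.sum_sub_distrib]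

/-- Lemma 3.1 in coordinates: `Y = ∑ fₖ • Xₖ` commutes with `Xⱼ` at `x` iff it is horizontal
for the reciprocal connection, whose Christoffel symbols are the structure constants `λ`. -/
theorem stmt1
    {E : Type*} [NormedAddCommGroup E] [NormedSpace ℂ E]
    (x : E) (r : ℕ) (X : Fin r → E → E)
    (hX : ∀ i, DifferentiableAt ℂ (X i) x)
    (hXindep : LinearIndependent ℂ (fun i => X i x))
    (lam : Fin r → Fin r → Fin r → ℂ)
    (hlam : ∀ i j, lieBracket ℂ (X j) (X i) x = ∑ k, lam j i k • X k x)
    (f : Fin r → E → ℂ)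
    (hf : ∀ k, DifferentiableAt ℂ (f k) x)
    (Y : E → E)
    (hY : Y = fun p => ∑ k, f k p • X k p) :
    ∀ j, lieBracket ℂ (X j) Y x = 0 ↔
      ∀ k, fderiv ℂ (f k) x (X j x) + ∑ i, f i x * lam j i k = 0 := by
  intro j
  have bracket_eq : lieBracket ℂ (X j) Y x =
      ∑ k, (fderiv ℂ (f k) x (X j x) + ∑ i, f i x * lam j i k) • X k x := by
    rw [hY, lieBracket_fun_sum_right fun k _ => (hf k).fun_smul (hX k)]
    simp only [lieBracket_smul_right (hf _) (hX _), hlam, add_smul, Finset.sum_add_distrib,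
      Finset.sum_smul, Finset.smul_sum, smul_smul]
    rw [Finset.sum_comm (f := fun i k => (f i x * lam j i k) • X k x)]
  rw [bracket_eq]
  exact ⟨Fintype.linearIndependent_iff.mp hXindep _, fun h => by simp [h]⟩
end

section
/- Let E be a complex normed space, U ⊆ E open, and Γ : E → (E →L[ℂ] E →L[ℂ] E) differentiable on U. Let Y, Z : E → E be vector fields that are differentiable on U and horizontal on U. Then for every p ∈ U the bracket [Y,Z] is differentiable at p and for every u ∈ E one has (∇Tor)(p)(u)(Y(p))(Z(p)) = − [ (D[Y,Z])ₚ(u) + Γ(p)(u)([Y,Z](p)) ]; that is, (∇ᵤ Tor)(Y,Z) = − ∇ᵤ[Y,Z] at every point of U. -/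
open VectorField

variable {E : Type*} [NormedAddCommGroup E] [NormedSpace ℂ E]

/-- The torsion of the connection with Christoffel map `Γ`. -/
noncomputable def torsion (Γ : E → (E →L[ℂ] E →L[ℂ] E)) (p : E) (u v : E) : E :=
  Γ p u v - Γ p v u

/-- The covariant derivative of the torsion of the connection with Christoffel map `Γ`. -/
noncomputable def nablaTorsion (Γ : E → (E →L[ℂ] E →L[ℂ] E)) (p : E) (u v w : E) : E :=
  fderiv ℂ (fun q => torsion Γ q v w) p u + Γ p u (torsion Γ p v w)
    - torsion Γ p (Γ p u v) w - torsion Γ p v (Γ p u w)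

/-- The product rule for the torsion evaluated on two vector fields. -/
theorem hasFDerivAt_torsion_apply {Γ : E → (E →L[ℂ] E →L[ℂ] E)} {Y Z : E → E} {p : E}
    {Γ' : E →L[ℂ] E →L[ℂ] E →L[ℂ] E} {Y' Z' : E →L[ℂ] E}
    (hΓ : HasFDerivAt Γ Γ' p) (hY : HasFDerivAt Y Y' p) (hZ : HasFDerivAt Z Z' p) :
    ∃ T' : E →L[ℂ] E, HasFDerivAt (fun q => torsion Γ q (Y q) (Z q)) T' p ∧
      ∀ u, T' u = Γ' u (Y p) (Z p) - Γ' u (Z p) (Y p)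
        + torsion Γ p (Y' u) (Z p) + torsion Γ p (Y p) (Z' u) := by
  refine ⟨_, ((hΓ.clm_apply hY).clm_apply hZ).sub ((hΓ.clm_apply hZ).clm_apply hY),
    fun u => ?_⟩
  simp [torsion]
  abel

/-- The bracket of two fields that are horizontal at `p` is minus their torsion. -/
theorem lieBracket_eq_neg_torsion {Γ : E → (E →L[ℂ] E →L[ℂ] E)} {Y Z : E → E} {p : E}
    (hY : ∀ u : E, fderiv ℂ Y p u + Γ p u (Y p) = 0)
    (hZ : ∀ u : E, fderiv ℂ Z p u + Γ p u (Z p) = 0) :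
    lieBracket ℂ Y Z p = -torsion Γ p (Y p) (Z p) := by
  rw [lieBracket, eq_neg_of_add_eq_zero_left (hY _), eq_neg_of_add_eq_zero_left (hZ _), torsion]
  abel

/-- The key identity in the proof of Proposition 3.8: for horizontal vector fields `Y`, `Z`,
`(∇ᵤ Tor)(Y,Z) = − ∇ᵤ[Y,Z]` at every point of `U`. -/
theorem stmt2
    (U : Set E) (hU : IsOpen U)
    (Γ : E → (E →L[ℂ] E →L[ℂ] E)) (hΓ : ∀ p ∈ U, DifferentiableAt ℂ Γ p)
    (Y Z : E → E)
    (hYdiff : ∀ p ∈ U, DifferentiableAt ℂ Y p)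
    (hZdiff : ∀ p ∈ U, DifferentiableAt ℂ Z p)
    (hYhor : ∀ p ∈ U, ∀ u : E, fderiv ℂ Y p u + Γ p u (Y p) = 0)
    (hZhor : ∀ p ∈ U, ∀ u : E, fderiv ℂ Z p u + Γ p u (Z p) = 0) :
    ∀ p ∈ U, DifferentiableAt ℂ (lieBracket ℂ Y Z) p ∧
      ∀ u : E, nablaTorsion Γ p u (Y p) (Z p) =
        - (fderiv ℂ (lieBracket ℂ Y Z) p u + Γ p u (lieBracket ℂ Y Z p)) := by
  intro p hp
  have hbr : lieBracket ℂ Y Z =ᶠ[nhds p] fun q => -torsion Γ q (Y q) (Z q) := by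
    filter_upwards [hU.mem_nhds hp] with q hq
    exact lieBracket_eq_neg_torsion (hYhor q hq) (hZhor q hq)
  have hΓp := (hΓ p hp).hasFDerivAt
  obtain ⟨T', hT, hT'⟩ :=
    hasFDerivAt_torsion_apply hΓp (hYdiff p hp).hasFDerivAt (hZdiff p hp).hasFDerivAt
  obtain ⟨S', hS, hS'⟩ :=
    hasFDerivAt_torsion_apply hΓp (hasFDerivAt_const (Y p) p) (hasFDerivAt_const (Z p) p)
  have hB := hT.neg.congr_of_eventuallyEq hbr
  refine ⟨hB.differentiableAt, fun u => ?_⟩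
  rw [nablaTorsion, hS.fderiv, hB.fderiv, hbr.eq_of_nhds, neg_apply, hT', hS',
    eq_neg_of_add_eq_zero_left (hYhor p hp u), eq_neg_of_add_eq_zero_left (hZhor p hp u)]
  simp [torsion]
  abel
end

section
/- Let V ⊆ ℂ be open and ν : ℂ → ℂ differentiable on V. On U = {(z₀,z₁,z₂) ∈ ℂ³ : z₀ ∈ V, z₁ ≠ 0} define the vector fields E₋₁(z₀,z₁,z₂) = (z₁, z₂, −ν(z₀)z₁³ + (3/2)z₂²/z₁), E₀(z₀,z₁,z₂) = (0, z₁, 2z₂), E₁(z₀,z₁,z₂) = (0, 0, 2z₁). Then at every point of U the three vectors E₋₁, E₀, E₁ are linearly independent and satisfy the commutation relations [E₋₁,E₀] = −E₋₁, [E₋₁,E₁] = −2·E₀, [E₀,E₁] = −E₁; in particular they span a Lie algebra isomorphic to 𝔰𝔩₂(ℂ) at each point, so they form an 𝔰𝔩₂-parallelism on U. -/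
open VectorField

/-- The derivative of the linear vector field `z₁ ∂₁ + 2 z₂ ∂₂`. -/
lemma fderiv_scalingField (w v : ℂ × ℂ × ℂ) :
    fderiv ℂ (fun w : ℂ × ℂ × ℂ => ((0 : ℂ), w.2.1, 2 * w.2.2)) w v = (0, v.2.1, 2 * v.2.2) := by
  have h1 : HasFDerivAt (𝕜 := ℂ) (fun w : ℂ × ℂ × ℂ => w.2.1) _ w := hasFDerivAt_snd.fst
  have h2 : HasFDerivAt (𝕜 := ℂ) (fun w : ℂ × ℂ × ℂ => w.2.2) _ w := hasFDerivAt_snd.snd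
  rw [((hasFDerivAt_const (0 : ℂ) w).prodMk (h1.prodMk (h2.const_mul 2))).fderiv]
  simp

/-- The derivative of the linear vector field `2 z₁ ∂₂`. -/
lemma fderiv_shearField (w v : ℂ × ℂ × ℂ) :
    fderiv ℂ (fun w : ℂ × ℂ × ℂ => ((0 : ℂ), (0 : ℂ), 2 * w.2.1)) w v = (0, 0, 2 * v.2.1) := by
  have h1 : HasFDerivAt (𝕜 := ℂ) (fun w : ℂ × ℂ × ℂ => w.2.1) _ w := hasFDerivAt_snd.fst
  rw [((hasFDerivAt_const (0 : ℂ) w).prodMk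
    ((hasFDerivAt_const (0 : ℂ) w).prodMk (h1.const_mul 2))).fderiv]
  simp

/-- The derivative of the Schwarzian vector field with potential `ν`. -/
lemma fderiv_schwarzianField {ν : ℂ → ℂ} {w : ℂ × ℂ × ℂ} (hν : DifferentiableAt ℂ ν w.1)
    (hw : w.2.1 ≠ 0) (v : ℂ × ℂ × ℂ) :
    fderiv ℂ (fun w : ℂ × ℂ × ℂ =>
      (w.2.1, w.2.2, - ν w.1 * w.2.1 ^ 3 + (3 / 2) * w.2.2 ^ 2 / w.2.1)) w v =
      (v.2.1, v.2.2, - deriv ν w.1 * w.2.1 ^ 3 * v.1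
        - (3 * ν w.1 * w.2.1 ^ 2 + (3 / 2) * w.2.2 ^ 2 / w.2.1 ^ 2) * v.2.1
        + 3 * w.2.2 / w.2.1 * v.2.2) := by
  have h0 : HasFDerivAt (𝕜 := ℂ) (fun w : ℂ × ℂ × ℂ => ν w.1) _ w :=
    hν.hasDerivAt.comp_hasFDerivAt w hasFDerivAt_fst
  have h1 : HasFDerivAt (𝕜 := ℂ) (fun w : ℂ × ℂ × ℂ => w.2.1) _ w := hasFDerivAt_snd.fst
  have h2 : HasFDerivAt (𝕜 := ℂ) (fun w : ℂ × ℂ × ℂ => w.2.2) _ w := hasFDerivAt_snd.snd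
  have h3 := (h0.neg.mul (h1.pow 3)).add (((h2.pow 2).const_mul (3 / 2)).mul
    ((hasDerivAt_inv hw).comp_hasFDerivAt w h1))
  have h := (h1.prodMk (h2.prodMk h3)).fderiv
  simp only [Pi.add_def, Pi.mul_def, Pi.neg_def, Function.comp_def,
    ← div_eq_mul_inv] at h
  rw [h]
  simp
  field_simp
  ring

/-- The Lemma of Section 5.2.2: the restrictions to the variety of Schwarzian arcs of the
standard `𝔰𝔩₂ ⊆ 𝔛̂` give an `𝔰𝔩₂`-parallelism on the open set where `z₁ ≠ 0`. -/
theorem stmt8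
    (V : Set ℂ) (hV : IsOpen V) (ν : ℂ → ℂ) (hν : ∀ z ∈ V, DifferentiableAt ℂ ν z)
    (Em1 E0 E1 : ℂ × ℂ × ℂ → ℂ × ℂ × ℂ)
    (hEm1 : Em1 = fun w =>
      (w.2.1, w.2.2, - ν w.1 * w.2.1 ^ 3 + (3 / 2) * w.2.2 ^ 2 / w.2.1))
    (hE0 : E0 = fun w => (0, w.2.1, 2 * w.2.2))
    (hE1 : E1 = fun w => (0, 0, 2 * w.2.1))
    (U : Set (ℂ × ℂ × ℂ)) (hU : U = {w : ℂ × ℂ × ℂ | w.1 ∈ V ∧ w.2.1 ≠ 0}) :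
    ∀ w ∈ U,
      LinearIndependent ℂ ![Em1 w, E0 w, E1 w] ∧
      lieBracket ℂ Em1 E0 w = - Em1 w ∧
      lieBracket ℂ Em1 E1 w = - (2 : ℂ) • E0 w ∧
      lieBracket ℂ E0 E1 w = - E1 w := by
  subst hEm1 hE0 hE1 hU
  rintro ⟨a, b, c⟩ ⟨ha, hb⟩
  replace hb : b ≠ 0 := hb
  refine ⟨?_, ?_, ?_, ?_⟩
  · rw [Fintype.linearIndependent_iff]
    intro g hg
    simp only [Fin.sum_univ_three, Matrix.cons_val, Prod.smul_mk, Prod.mk_add_mk, smul_eq_mul,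
      Prod.mk_eq_zero] at hg
    obtain ⟨h0, h1, h2⟩ := hg
    have g0 : g 0 = 0 := by simpa [hb] using h0
    have g1 : g 1 = 0 := by simpa [hb, g0] using h1
    have g2 : g 2 = 0 := by simpa [hb, g0, g1] using h2
    intro i
    fin_cases i <;> assumption
  · simp only [lieBracket]
    rw [fderiv_scalingField, fderiv_schwarzianField (hν a ha) hb]
    ext <;> simp
    · ring
    · field_simp
      ring
  · simp only [lieBracket]
    rw [fderiv_shearField, fderiv_schwarzianField (hν a ha) hb]
    ext <;> simp
    field_simp
    ring
  · simp only [lieBracket]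
    rw [fderiv_scalingField, fderiv_shearField]
    ext <;> simp
    ring
end

section
/- Let ν : ℂ → ℂ and define f : ℂ⁴ → ℂ by f(z₀,z₁,z₂,z₃) = z₃/z₁ − (3/2)(z₂/z₁)² + ν(z₀)z₁². Let p = (z₀,z₁,z₂,z₃) with z₁ ≠ 0 and ν differentiable at z₀. Then f is differentiable at p and its Fréchet derivative satisfies (Df)ₚ(0, z₁, 2z₂, 3z₃) = 2·f(p) and (Df)ₚ(0, 0, 2z₁, 6z₂) = 0. -/
/-- The quotient rule for Fréchet derivatives of scalar-valued functions. -/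
theorem hasFDerivAt_fun_div {𝕜 E : Type*} [NontriviallyNormedField 𝕜] [NormedAddCommGroup E]
    [NormedSpace 𝕜 E] {c d : E → 𝕜} {c' d' : E →L[𝕜] 𝕜} {x : E} (hc : HasFDerivAt c c' x)
    (hd : HasFDerivAt d d' x) (hx : d x ≠ 0) :
    HasFDerivAt (fun y => c y / d y) ((d x ^ 2)⁻¹ • (d x • c' - c x • d')) x := by
  have h := hc.fun_mul ((hasDerivAt_inv hx).comp_hasFDerivAt x hd)
  simp only [Function.comp_apply, ← div_eq_mul_inv] at h
  refine h.congr_fderiv ?_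
  ext v
  simp
  field_simp
  ring

/-- The identities `E₀·f = 2f` and `E₁·f = 0` from the proof of the Lemma in Section 5.2.2,
for the Schwarzian-derivative function `f(z₀,z₁,z₂,z₃) = z₃/z₁ − (3/2)(z₂/z₁)² + ν(z₀)z₁²`. -/
theorem stmt9
    (ν : ℂ → ℂ) (f : ℂ × ℂ × ℂ × ℂ → ℂ)
    (hf : f = fun w => w.2.2.2 / w.2.1 - (3 / 2) * (w.2.2.1 / w.2.1) ^ 2 + ν w.1 * w.2.1 ^ 2)
    (z₀ z₁ z₂ z₃ : ℂ) (hz₁ : z₁ ≠ 0) (hν : DifferentiableAt ℂ ν z₀) :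
    DifferentiableAt ℂ f (z₀, z₁, z₂, z₃) ∧
    fderiv ℂ f (z₀, z₁, z₂, z₃) (0, z₁, 2 * z₂, 3 * z₃) = 2 * f (z₀, z₁, z₂, z₃) ∧
    fderiv ℂ f (z₀, z₁, z₂, z₃) (0, 0, 2 * z₁, 6 * z₂) = 0 := by
  subst hf
  have h₀ : HasFDerivAt (fun w : ℂ × ℂ × ℂ × ℂ => w.1) (.fst ℂ ℂ (ℂ × ℂ × ℂ))
      (z₀, z₁, z₂, z₃) := hasFDerivAt_fst
  have hsnd := hasFDerivAt_snd (𝕜 := ℂ) (E := ℂ) (F := ℂ × ℂ × ℂ) (p := (z₀, z₁, z₂, z₃))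
  have h₁ := hsnd.fst
  have h₂ := hsnd.snd.fst
  have h₃ := hsnd.snd.snd
  have hνw := HasFDerivAt.comp (z₀, z₁, z₂, z₃) (f := fun w : ℂ × ℂ × ℂ × ℂ => w.1)
    hν.hasFDerivAt h₀
  have h := ((hasFDerivAt_fun_div h₃ h₁ hz₁).fun_sub
    (((hasFDerivAt_fun_div h₂ h₁ hz₁).pow 2).const_mul (3 / 2))).fun_add
    (hνw.fun_mul (h₁.pow 2))
  refine ⟨h.differentiableAt, ?_, ?_⟩
  · refine (congrArg (· (0, z₁, 2 * z₂, 3 * z₃)) h.fderiv).trans ?_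
    simp
    field_simp
    ring
  · refine (congrArg (· (0, 0, 2 * z₁, 6 * z₂)) h.fderiv).trans ?_
    simp
    field_simp
    ring
end

section
/- Let G be a group acting on a topological space P such that for every g ∈ G the map p ↦ g • p is a homeomorphism, and assume P is a Noetherian topological space. Let L', L'' ⊆ P and g, h ∈ G be such that g • closure(L') ⊆ closure(L'') and h • closure(L'') ⊆ closure(L'). Then g • closure(L') = closure(L''). -/
open Pointwise

/-- In a Noetherian space, a closed set that is mapped into itself by a translation is
invariant under that translation. -/
theorem IsClosed.smul_eq_of_smul_subset {G P : Type*} [Group G] [TopologicalSpace P]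
    [MulAction G P] [ContinuousConstSMul G P] [TopologicalSpace.NoetherianSpace P]
    {Z : Set P} (hZ : IsClosed Z) {k : G} (hk : k • Z ⊆ Z) : k • Z = Z := by
  suffices H : ∀ C : TopologicalSpace.Closeds P, k • (C : Set P) ⊆ C → (C : Set P) ⊆ k • (C : Set P)
    from hk.antisymm (H ⟨Z, hZ⟩ hk)
  intro C
  induction C using WellFoundedLT.induction with
  | ind C ih =>
    intro hC
    by_contra hne
    have hlt : (⟨k • (C : Set P), C.isClosed.smul k⟩ : TopologicalSpace.Closeds P) < C := ⟨hC, hne⟩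
    exact hne (Set.smul_set_subset_smul_set_iff.mp
      (ih _ hlt (Set.smul_set_mono hC)))

/-- The topological core of Theorem A.2 (uniqueness of the Zariski closure of a leaf up to a
group translation): if a group `G` acts by homeomorphisms on a Noetherian topological space
`P`, and `g • closure L' ⊆ closure L''` while `h • closure L'' ⊆ closure L'`, then
`g • closure L' = closure L''`. -/
theorem stmt14
    {G : Type*} {P : Type*} [Group G] [TopologicalSpace P] [MulAction G P]
    [TopologicalSpace.NoetherianSpace P]
    (hcont : ∀ g : G, Continuous fun p : P => g • p)
    (L' L'' : Set P) (g h : G)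
    (hg : g • closure L' ⊆ closure L'')
    (hh : h • closure L'' ⊆ closure L') :
    g • closure L' = closure L'' := by
  have : ContinuousConstSMul G P := ⟨hcont⟩
  have hgh : (g * h) • closure L'' ⊆ g • closure L' := by
    rw [mul_smul]
    exact Set.smul_set_mono hh
  refine hg.antisymm ?_
  rwa [isClosed_closure.smul_eq_of_smul_subset (hgh.trans hg)] at hgh
end
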